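/- arXiv:2405.10978 — 4 statements merged into one kernel-verified Lean document; each statement's English description precedes it below -/
import Mathlib

section
/- Let n, b, c be integers with n ≥ 1 and b ≥ c ≥ 1. Then ∑_{k=0}^{n} (-1)^k · (C(n,k)/C(b+k,c)) · (H_{k+b} − H_{k+b−c}) = (c/(n+c)) · (H_{n+b} − H_{b−c}) / C(n+b, n+c), where all quotients are taken in ℚ (equivalently ℝ). -/
theorem alternating_sum_choose_succ (n : ℕ) (f : ℕ → ℚ) :
    ∑ k ∈ Finset.range (n + 2), (-1 : ℚ) ^ k * ((n + 1).choose k : ℚ) * f k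
      = ∑ k ∈ Finset.range (n + 1), (-1 : ℚ) ^ k * (n.choose k : ℚ) * f k
        - ∑ k ∈ Finset.range (n + 1), (-1 : ℚ) ^ k * (n.choose k : ℚ) * f (k + 1) := by
  have h : ∑ k ∈ Finset.range (n + 1), (-1 : ℚ) ^ k * (n.choose k : ℚ) * f k
      = ∑ k ∈ Finset.range (n + 2), (-1 : ℚ) ^ k * (n.choose k : ℚ) * f k := by
    rw [Finset.sum_range_succ _ (n + 1)]
    simp
  rw [h, Finset.sum_range_succ' _ (n + 1), Finset.sum_range_succ' _ (n + 1),
    add_sub_right_comm, ← Finset.sum_sub_distrib]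
  simp only [Nat.choose_zero_right]
  congr 1
  refine Finset.sum_congr rfl fun k _ => ?_
  rw [Nat.choose_succ_succ]
  push_cast
  ring

theorem alternating_sum_inv_choose_mul_harmonic_sub (n c d : ℕ) (hc : 1 ≤ c) :
    ∑ k ∈ Finset.range (n + 1), (-1 : ℚ) ^ k * (n.choose k : ℚ) *
        ((harmonic (k + (d + c)) - harmonic (k + d)) / ((d + c + k).choose c : ℚ))
      = (c : ℚ) / ((n : ℚ) + c) *
          ((harmonic (n + (d + c)) - harmonic d) / ((n + (d + c)).choose (n + c) : ℚ)) := by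
  have hc0 : (0 : ℚ) < c := by exact_mod_cast hc
  induction n generalizing d with
  | zero => simp [hc0.ne']
  | succ n ih =>
    have hshift : ∑ k ∈ Finset.range (n + 1), (-1 : ℚ) ^ k * (n.choose k : ℚ) *
          ((harmonic (k + 1 + (d + c)) - harmonic (k + 1 + d)) /
            ((d + c + (k + 1)).choose c : ℚ))
        = (c : ℚ) / ((n : ℚ) + c) * ((harmonic (n + (d + 1 + c)) - harmonic (d + 1)) /
            ((n + (d + 1 + c)).choose (n + c) : ℚ)) := by
      rw [← ih (d + 1)]
      refine Finset.sum_congr rfl fun k _ => ?_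
      rw [show k + 1 + (d + c) = k + (d + 1 + c) by ring, show k + 1 + d = k + (d + 1) by ring,
        show d + c + (k + 1) = d + 1 + c + k by ring]
    rw [alternating_sum_choose_succ n
        (fun k => (harmonic (k + (d + c)) - harmonic (k + d)) / ((d + c + k).choose c : ℚ)),
      ih d, hshift, show n + (d + 1 + c) = n + (d + c) + 1 by ring,
      show n + 1 + (d + c) = n + (d + c) + 1 by ring, show n + 1 + c = n + c + 1 by ring,
      harmonic_succ, harmonic_succ]
    have hX : ((n + (d + c)).choose (n + c) : ℚ) ≠ 0 := by
      exact_mod_cast (Nat.choose_pos (by omega)).ne'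
    have h1 : ((n + (d + c) + 1).choose (n + c + 1) : ℚ)
        = (n + (d + c)).choose (n + c) * ((n + (d + c) + 1) / (n + c + 1)) := by
      have h := Nat.add_one_mul_choose_eq (n + (d + c)) (n + c)
      rw [← mul_div_assoc, eq_div_iff (by positivity)]
      have h' := congrArg (Nat.cast (R := ℚ)) h
      push_cast at h'
      linarith
    have h2 : ((n + (d + c) + 1).choose (n + c) : ℚ)
        = (n + (d + c)).choose (n + c) * ((n + (d + c) + 1) / (d + 1)) := by
      have h := Nat.choose_mul_succ_eq (n + (d + c)) (n + c)
      rw [show n + (d + c) + 1 - (n + c) = d + 1 by omega] at h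
      rw [← mul_div_assoc, eq_div_iff (by positivity)]
      have h' := congrArg (Nat.cast (R := ℚ)) h
      push_cast at h'
      linarith
    rw [h1, h2]
    have hN : (n : ℚ) + (d + c) + 1 ≠ 0 := by positivity
    have hnc : (n : ℚ) + c ≠ 0 := by positivity
    have hnc' : (n : ℚ) + c + 1 ≠ 0 := by positivity
    have hnc'' : (n : ℚ) + 1 + c ≠ 0 := by positivity
    have hd : (d : ℚ) + 1 ≠ 0 := by positivity
    push_cast
    field_simp
    ring

/- `harmonic m = ∑_{j=1}^m 1/j` is Mathlib's harmonic number `harmonic : ℕ → ℚ`. -/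

theorem frisch_harmonic_b (n b c : ℕ) (hn : 1 ≤ n) (hc : 1 ≤ c) (hbc : c ≤ b) :
    ∑ k ∈ Finset.range (n + 1),
        (-1 : ℚ) ^ k * ((n.choose k : ℚ) / ((b + k).choose c : ℚ)) *
          (harmonic (k + b) - harmonic (k + b - c))
      = (c : ℚ) / ((n : ℚ) + c) *
          ((harmonic (n + b) - harmonic (b - c)) / ((n + b).choose (n + c) : ℚ)) := by
  obtain ⟨d, rfl⟩ := Nat.exists_eq_add_of_le' hbc
  rw [Nat.add_sub_cancel, ← alternating_sum_inv_choose_mul_harmonic_sub n c d hc]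
  refine Finset.sum_congr rfl fun k _ => ?_
  rw [← add_assoc k d c, Nat.add_sub_cancel]
  ring
end

section
/- Let n and b be integers with n ≥ 0 and b ≥ 1. Then ∑_{k=1}^{n} (-1)^{k+1} · C(n,k) · k / (k+b)^2 = (H_{n+b} − H_b) / C(n+b, n), where all quotients are taken in ℚ (equivalently ℝ). -/
/- `harmonic m = ∑_{j=1}^m 1/j` is Mathlib's harmonic number `harmonic : ℕ → ℚ`. -/

theorem sum_neg_one_pow_mul_choose_succ {R : Type*} [CommRing R] (n : ℕ) (g : ℕ → R) :
    ∑ k ∈ Finset.range (n + 2), (-1) ^ k * ((n + 1).choose k : R) * g k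
      = ∑ k ∈ Finset.range (n + 1), (-1) ^ k * (n.choose k : R) * g k
        - ∑ k ∈ Finset.range (n + 1), (-1) ^ k * (n.choose k : R) * g (k + 1) := by
  have h : ∑ k ∈ Finset.range (n + 1), (-1) ^ k * (n.choose k : R) * g k
      = ∑ k ∈ Finset.range (n + 2), (-1) ^ k * (n.choose k : R) * g k := by
    simp [Finset.sum_range_succ _ (n + 1)]
  rw [h, Finset.sum_range_succ', Finset.sum_range_succ' _ (n + 1), add_sub_right_comm,
    ← Finset.sum_sub_distrib]
  simp only [Nat.choose_zero_right]
  congr 1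
  refine Finset.sum_congr rfl fun k _ => ?_
  rw [Nat.choose_succ_succ]
  push_cast
  ring

theorem choose_add_succ_right_mul (n b : ℕ) :
    ((n + (b + 1)).choose n : ℚ) = (n + b + 1) * (n + b).choose n / (b + 1) := by
  have h := Nat.add_one_mul_choose_eq (n + b) b
  rw [show n + b + 1 = n + (b + 1) by ring, ← Nat.choose_symm_add, ← Nat.choose_symm_add] at h
  rw [eq_div_iff (by positivity)]
  exact_mod_cast h.symm

theorem choose_succ_add_left_mul (n b : ℕ) :
    ((n + b + 1).choose (n + 1) : ℚ) = (n + b + 1) * (n + b).choose n / (n + 1) := by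
  have h := Nat.add_one_mul_choose_eq (n + b) n
  rw [eq_div_iff (by positivity)]
  exact_mod_cast h.symm

theorem alternating_sum_choose_inv (n : ℕ) : ∀ b : ℕ, 1 ≤ b →
    ∑ k ∈ Finset.range (n + 1), (-1 : ℚ) ^ k * (n.choose k : ℚ) * ((k + b : ℕ) : ℚ)⁻¹
      = 1 / (b * (n + b).choose n) := by
  induction n with
  | zero => intro b hb; simp
  | succ n ih =>
    intro b hb
    rw [sum_neg_one_pow_mul_choose_succ n fun k => ((k + b : ℕ) : ℚ)⁻¹, ih b hb]
    simp only [add_assoc, add_comm 1 b]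
    rw [ih (b + 1) (by omega), choose_add_succ_right_mul, ← add_assoc n b 1,
      choose_succ_add_left_mul]
    have hb0 : (b : ℚ) ≠ 0 := by positivity
    have hP : ((n + b).choose n : ℚ) ≠ 0 := by
      exact_mod_cast (Nat.choose_pos (Nat.le_add_right n b)).ne'
    have hnb : (n + b + 1 : ℚ) ≠ 0 := by positivity
    have hn : (n + 1 : ℚ) ≠ 0 := by positivity
    push_cast
    field_simp
    ring

theorem alternating_sum_choose_inv_sq (n : ℕ) : ∀ b : ℕ, 1 ≤ b →
    ∑ k ∈ Finset.range (n + 1), (-1 : ℚ) ^ k * (n.choose k : ℚ) * (((k + b : ℕ) : ℚ) ^ 2)⁻¹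
      = (harmonic (n + b) - harmonic b + (b : ℚ)⁻¹) / (b * (n + b).choose n) := by
  induction n with
  | zero => intro b hb; simp; field_simp
  | succ n ih =>
    intro b hb
    rw [sum_neg_one_pow_mul_choose_succ n fun k => (((k + b : ℕ) : ℚ) ^ 2)⁻¹, ih b hb]
    simp only [add_assoc, add_comm 1 b]
    rw [ih (b + 1) (by omega), choose_add_succ_right_mul, ← add_assoc n b 1, harmonic_succ (n + b),
      harmonic_succ b, choose_succ_add_left_mul]
    have hb0 : (b : ℚ) ≠ 0 := by positivity
    have hP : ((n + b).choose n : ℚ) ≠ 0 := by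
      exact_mod_cast (Nat.choose_pos (Nat.le_add_right n b)).ne'
    have hnb : (n + b + 1 : ℚ) ≠ 0 := by positivity
    have hn : (n + 1 : ℚ) ≠ 0 := by positivity
    push_cast
    field_simp
    ring

theorem alternating_sum_k_inv_sq (n b : ℕ) (hb : 1 ≤ b) :
    ∑ k ∈ Finset.Icc 1 n,
        (-1 : ℚ) ^ (k + 1) * (n.choose k : ℚ) * (k : ℚ) / ((k : ℚ) + b) ^ 2
      = (harmonic (n + b) - harmonic b) / ((n + b).choose n : ℚ) := by
  have hb0 : (b : ℚ) ≠ 0 := by positivity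
  have hP : ((n + b).choose n : ℚ) ≠ 0 := by
    exact_mod_cast (Nat.choose_pos (Nat.le_add_right n b)).ne'
  have hsum : ∑ k ∈ Finset.Icc 1 n,
        (-1 : ℚ) ^ (k + 1) * (n.choose k : ℚ) * (k : ℚ) / ((k : ℚ) + b) ^ 2
      = ∑ k ∈ Finset.range (n + 1),
        (-1 : ℚ) ^ (k + 1) * (n.choose k : ℚ) * (k : ℚ) / ((k : ℚ) + b) ^ 2 := by
    refine Finset.sum_subset (fun k hk => ?_) fun k hk hk' => ?_
    · simp only [Finset.mem_Icc, Finset.mem_range] at *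
      omega
    · have : k = 0 := by
        simp only [Finset.mem_Icc, Finset.mem_range] at *
        omega
      simp [this]
  have hsplit : ∑ k ∈ Finset.range (n + 1),
        (-1 : ℚ) ^ (k + 1) * (n.choose k : ℚ) * (k : ℚ) / ((k : ℚ) + b) ^ 2
      = b * ∑ k ∈ Finset.range (n + 1),
          (-1 : ℚ) ^ k * (n.choose k : ℚ) * (((k + b : ℕ) : ℚ) ^ 2)⁻¹
        - ∑ k ∈ Finset.range (n + 1),
          (-1 : ℚ) ^ k * (n.choose k : ℚ) * ((k + b : ℕ) : ℚ)⁻¹ := by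
    rw [Finset.mul_sum, ← Finset.sum_sub_distrib]
    refine Finset.sum_congr rfl fun k _ => ?_
    have hkb : (k + b : ℚ) ≠ 0 := by positivity
    push_cast
    field_simp
    ring
  rw [hsum, hsplit, alternating_sum_choose_inv n b hb, alternating_sum_choose_inv_sq n b hb]
  field_simp
  ring
end

section
/- Let n and b be integers with n ≥ 0 and b ≥ 1. Then ∑_{k=0}^{n} (-1)^k · C(n,k) / (k+b)^3 = (1/(2n+2)) · (1/C(n+b, n+1)) · ( (H_{n+b} − H_{b−1})^2 − H^{(2)}_{b−1} + H^{(2)}_{n+b} ), where all quotients are taken in ℚ (equivalently ℝ). -/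
/- `harmonic m = ∑_{j=1}^m 1/j` is Mathlib's harmonic number `harmonic : ℕ → ℚ`. -/

/-- The second-order harmonic number `H^{(2)} m = ∑_{j=1}^m 1/j^2`. -/
def harmonic2 (m : ℕ) : ℚ := ∑ j ∈ Finset.range m, (1 : ℚ) / ((j : ℚ) + 1) ^ 2

/-- Pascal's rule for alternating binomial sums. -/
theorem sum_alternating_choose_succ {R : Type*} [CommRing R] (f : ℕ → R) (n : ℕ) :
    ∑ k ∈ Finset.range (n + 2), (-1 : R) ^ k * ((n + 1).choose k : R) * f k
      = ∑ k ∈ Finset.range (n + 1), (-1 : R) ^ k * (n.choose k : R) * f k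
        - ∑ k ∈ Finset.range (n + 1), (-1 : R) ^ k * (n.choose k : R) * f (k + 1) := by
  have h : ∑ k ∈ Finset.range (n + 1), (-1 : R) ^ k * (n.choose k : R) * f k
      = ∑ k ∈ Finset.range (n + 1), (-1 : R) ^ (k + 1) * (n.choose (k + 1) : R) * f (k + 1)
        + f 0 := by
    rw [Finset.sum_range_succ', Finset.sum_range_succ _ n]
    simp
  rw [Finset.sum_range_succ', h, add_sub_right_comm, ← Finset.sum_sub_distrib]
  congr 1
  · refine Finset.sum_congr rfl fun k _ => ?_
    rw [Nat.choose_succ_succ]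
    push_cast
    ring
  · simp

theorem harmonic2_succ (m : ℕ) :
    harmonic2 (m + 1) = harmonic2 m + 1 / ((m : ℚ) + 1) ^ 2 :=
  Finset.sum_range_succ _ m

theorem alternating_sum_inv_cube_succ (n c : ℕ) :
    ∑ k ∈ Finset.range (n + 1),
        (-1 : ℚ) ^ k * (n.choose k : ℚ) * (1 / ((k : ℚ) + c + 1) ^ 3)
      = 1 / (2 * (n : ℚ) + 2) * (1 / ((n + c + 1).choose (n + 1) : ℚ)) *
          ((harmonic (n + c + 1) - harmonic c) ^ 2
            - harmonic2 c + harmonic2 (n + c + 1)) := by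
  induction n generalizing c with
  | zero =>
    simp only [zero_add, harmonic_succ, harmonic2_succ, Finset.sum_range_one, Nat.choose_one_right]
    push_cast
    have : (c : ℚ) + 1 ≠ 0 := by positivity
    simp
    field_simp
    ring
  | succ n ih =>
    have ih' := ih (c + 1)
    rw [sum_alternating_choose_succ (fun k : ℕ => 1 / ((k : ℚ) + c + 1) ^ 3), ih c]
    have shift : ∀ k : ℕ, ((k + 1 : ℕ) : ℚ) + c + 1 = (k : ℚ) + ((c + 1 : ℕ) : ℚ) + 1 := by
      intro k
      push_cast
      ring
    simp only [shift]
    rw [ih', show n + (c + 1) + 1 = n + c + 1 + 1 by ring,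
      show n + 1 + c + 1 = n + c + 1 + 1 by ring]
    have h₁ : ((n : ℚ) + c + 2) * ((n + c + 1).choose (n + 1) : ℚ)
        = ((n + c + 1 + 1).choose (n + 1 + 1) : ℚ) * (n + 2) := by
      have := Nat.add_one_mul_choose_eq (n + c + 1) (n + 1)
      have := congrArg (Nat.cast : ℕ → ℚ) this
      push_cast at this
      linear_combination this
    have h₂ : ((n + c + 1).choose (n + 1) : ℚ) * ((n : ℚ) + c + 2)
        = ((n + c + 1 + 1).choose (n + 1) : ℚ) * (c + 1) := by
      have := Nat.choose_mul_succ_eq (n + c + 1) (n + 1)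
      rw [show n + c + 1 + 1 - (n + 1) = c + 1 by omega] at this
      have := congrArg (Nat.cast : ℕ → ℚ) this
      push_cast at this
      linear_combination this
    have hC : ((n + c + 1).choose (n + 1) : ℚ) ≠ 0 := by
      exact_mod_cast (Nat.choose_pos (by omega)).ne'
    have hc : (c : ℚ) + 1 ≠ 0 := by positivity
    have hn : (n : ℚ) + 1 ≠ 0 := by positivity
    have hn₂ : (n : ℚ) + 2 ≠ 0 := by positivity
    have hN : (n : ℚ) + c + 2 ≠ 0 := by positivity
    rw [eq_comm, ← eq_div_iff hn₂] at h₁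
    rw [eq_comm, ← eq_div_iff hc] at h₂
    rw [h₁, h₂, harmonic_succ (n + c + 1), harmonic2_succ (n + c + 1), harmonic_succ c,
      harmonic2_succ c]
    push_cast
    rw [show (n : ℚ) + c + 1 + 1 = n + c + 2 by ring,
      show 2 * ((n : ℚ) + 1) + 2 = 2 * (n + 2) by ring,
      show 2 * (n : ℚ) + 2 = 2 * (n + 1) by ring]
    field_simp
    ring

theorem alternating_sum_inv_cube (n b : ℕ) (hb : 1 ≤ b) :
    ∑ k ∈ Finset.range (n + 1),
        (-1 : ℚ) ^ k * (n.choose k : ℚ) / ((k : ℚ) + b) ^ 3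
      = 1 / (2 * (n : ℚ) + 2) * (1 / ((n + b).choose (n + 1) : ℚ)) *
          ((harmonic (n + b) - harmonic (b - 1)) ^ 2
            - harmonic2 (b - 1) + harmonic2 (n + b)) := by
  obtain ⟨c, rfl⟩ := Nat.exists_eq_add_of_le' hb
  rw [Nat.add_sub_cancel, ← add_assoc, ← alternating_sum_inv_cube_succ]
  refine Finset.sum_congr rfl fun k _ => ?_
  push_cast
  ring
end

section
/- Let n be an integer with n ≥ 0. Then ∑_{k=0}^{n} (-1)^{k-1} · C(n,k) / (2k−1)^3 = (2^{2n−1} / C(2n, n)) · ( (O_n − 1)^2 + O^{(2)}_n + 1 ), where all quotients are taken in ℚ (equivalently ℝ); here (2k−1)^3 for k = 0 equals −1, and 2^{2n−1} denotes 2^{2n}/2 in ℚ. -/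
/-- The odd harmonic number `O m = ∑_{j=1}^m 1/(2j-1)`. -/
def oddHarmonic (m : ℕ) : ℚ := ∑ j ∈ Finset.range m, (1 : ℚ) / (2 * (j : ℚ) + 1)

/-- The second-order odd harmonic number `O^{(2)} m = ∑_{j=1}^m 1/(2j-1)^2`. -/
def oddHarmonic2 (m : ℕ) : ℚ := ∑ j ∈ Finset.range m, (1 : ℚ) / (2 * (j : ℚ) + 1) ^ 2

/-- The alternating binomial sum `∑_{k=0}^n (-1)^{k+1} C(n,k) / (2k-1)^p`. -/
def alternatingOddSum (p n : ℕ) : ℚ :=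
  ∑ k ∈ Finset.range (n + 1), (-1 : ℚ) ^ (k + 1) * (n.choose k : ℚ) / (2 * (k : ℚ) - 1) ^ p

lemma two_mul_natCast_sub_one_ne_zero (k : ℕ) : (2 * (k : ℚ) - 1) ≠ 0 := by
  intro h
  have h' : (2 * (k : ℤ) - 1) = 0 := by exact_mod_cast h
  omega

lemma alternatingOddSum_zero_succ (n : ℕ) : alternatingOddSum 0 (n + 1) = 0 := by
  have h := add_pow (-1 : ℚ) 1 (n + 1)
  simp only [neg_add_cancel, ne_eq, Nat.add_eq_zero_iff, one_ne_zero, and_false,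
    not_false_eq_true, zero_pow, one_pow, mul_one] at h
  simp only [alternatingOddSum, pow_zero, div_one, pow_succ (-1 : ℚ), mul_neg, mul_one,
    neg_mul, Finset.sum_neg_distrib]
  rw [← h, neg_zero]

lemma alternatingOddSum_succ (p n : ℕ) :
    (2 * n + 1) * alternatingOddSum (p + 1) (n + 1) =
      alternatingOddSum p (n + 1) + 2 * (n + 1) * alternatingOddSum (p + 1) n := by
  have hext : alternatingOddSum (p + 1) n = ∑ k ∈ Finset.range (n + 1 + 1),
      (-1 : ℚ) ^ (k + 1) * (n.choose k : ℚ) / (2 * (k : ℚ) - 1) ^ (p + 1) := by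
    simp [alternatingOddSum, Finset.sum_range_succ _ (n + 1)]
  rw [hext, alternatingOddSum, alternatingOddSum, Finset.mul_sum, Finset.mul_sum,
    ← Finset.sum_add_distrib]
  refine Finset.sum_congr rfl fun k hk => ?_
  have hk' : k ≤ n + 1 := Nat.lt_succ_iff.mp (Finset.mem_range.mp hk)
  have hc : (n.choose k : ℚ) * (n + 1) = (n + 1).choose k * (n + 1 - k) := by
    have := congrArg (Nat.cast : ℕ → ℚ) (Nat.choose_mul_succ_eq n k)
    push_cast [Nat.cast_sub hk'] at this
    exact this
  have h0 := two_mul_natCast_sub_one_ne_zero k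
  have hp : ((-1 : ℚ) ^ (k + 1) * ((n + 1).choose k : ℚ)) / (2 * (k : ℚ) - 1) ^ p =
      (-1 : ℚ) ^ (k + 1) * ((n + 1).choose k : ℚ) * (2 * k - 1) / (2 * (k : ℚ) - 1) ^ (p + 1) := by
    rw [pow_succ (2 * (k : ℚ) - 1), mul_div_mul_right _ _ h0]
  rw [hp]
  linear_combination (-2) * (-1) ^ (k + 1) / (2 * (k : ℚ) - 1) ^ (p + 1) * hc

/-- The normalized central binomial coefficient `4^n / C(2n,n)` satisfies a first-order
recurrence. -/
lemma two_pow_div_choose_succ (n : ℕ) :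
    (2 * n + 1) * ((2 : ℚ) ^ (2 * (n + 1)) / (((2 * (n + 1)).choose (n + 1) : ℕ) : ℚ)) =
      2 * (n + 1) * ((2 : ℚ) ^ (2 * n) / (((2 * n).choose n : ℕ) : ℚ)) := by
  rw [← Nat.centralBinom_eq_two_mul_choose, ← Nat.centralBinom_eq_two_mul_choose]
  have h : ((n : ℚ) + 1) * (n + 1).centralBinom = 2 * (2 * n + 1) * n.centralBinom := by
    exact_mod_cast Nat.succ_mul_centralBinom_succ n
  have h0 : (n.centralBinom : ℚ) ≠ 0 := by exact_mod_cast n.centralBinom_ne_zero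
  have h1 : ((n + 1).centralBinom : ℚ) ≠ 0 := by exact_mod_cast (n + 1).centralBinom_ne_zero
  rw [mul_div_assoc', mul_div_assoc', div_eq_div_iff h1 h0]
  have h2 : (2 : ℚ) ^ (2 * (n + 1)) = 4 * 2 ^ (2 * n) := by ring
  rw [h2]
  linear_combination (-2) * 2 ^ (2 * n) * h

lemma alternatingOddSum_one (n : ℕ) :
    alternatingOddSum 1 n = (2 : ℚ) ^ (2 * n) / (((2 * n).choose n : ℕ) : ℚ) := by
  induction n with
  | zero => simp [alternatingOddSum]
  | succ n ih =>
    have h0 : (2 * (n : ℚ) + 1) ≠ 0 := by positivity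
    apply mul_left_cancel₀ h0
    rw [alternatingOddSum_succ, alternatingOddSum_zero_succ, two_pow_div_choose_succ, ih, zero_add]

lemma alternatingOddSum_two (n : ℕ) :
    alternatingOddSum 2 n =
      (2 : ℚ) ^ (2 * n) / (((2 * n).choose n : ℕ) : ℚ) * (oddHarmonic n - 1) := by
  induction n with
  | zero => simp [alternatingOddSum, oddHarmonic]
  | succ n ih =>
    have h0 : (2 * (n : ℚ) + 1) ≠ 0 := by positivity
    have hO : oddHarmonic (n + 1) = oddHarmonic n + 1 / (2 * n + 1) := by
      simp [oddHarmonic, Finset.sum_range_succ]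
    apply mul_left_cancel₀ h0
    rw [alternatingOddSum_succ, alternatingOddSum_one, ih, ← mul_assoc, ← mul_assoc,
      ← two_pow_div_choose_succ, hO]
    field_simp
    ring

theorem alternating_sum_odd_cube (n : ℕ) :
    ∑ k ∈ Finset.range (n + 1),
        (-1 : ℚ) ^ (k + 1) * (n.choose k : ℚ) / (2 * (k : ℚ) - 1) ^ 3
      = (2 : ℚ) ^ (2 * n) / 2 / (((2 * n).choose n : ℕ) : ℚ) *
          ((oddHarmonic n - 1) ^ 2 + oddHarmonic2 n + 1) := by
  change alternatingOddSum 3 n = _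
  induction n with
  | zero => norm_num [alternatingOddSum, oddHarmonic, oddHarmonic2]
  | succ n ih =>
    have h0 : (2 * (n : ℚ) + 1) ≠ 0 := by positivity
    have hO : oddHarmonic (n + 1) = oddHarmonic n + 1 / (2 * n + 1) := by
      simp [oddHarmonic, Finset.sum_range_succ]
    have hO2 : oddHarmonic2 (n + 1) = oddHarmonic2 n + 1 / (2 * n + 1) ^ 2 := by
      simp [oddHarmonic2, Finset.sum_range_succ]
    apply mul_left_cancel₀ h0
    rw [alternatingOddSum_succ, alternatingOddSum_two, ih,
      div_right_comm ((2 : ℚ) ^ (2 * n)), div_right_comm ((2 : ℚ) ^ (2 * (n + 1))),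
      hO, hO2]
    have hA := two_pow_div_choose_succ n
    generalize (2 : ℚ) ^ (2 * (n + 1)) / (((2 * (n + 1)).choose (n + 1) : ℕ) : ℚ) = B at hA ⊢
    generalize (2 : ℚ) ^ (2 * n) / (((2 * n).choose n : ℕ) : ℚ) = A at hA ⊢
    have hx : (2 * (n : ℚ) + 1) * (1 / (2 * n + 1)) = 1 := mul_one_div_cancel h0
    rw [← one_div_pow]
    generalize 1 / (2 * (n : ℚ) + 1) = x at hx ⊢
    linear_combination
      (-((oddHarmonic n - 1) ^ 2 + oddHarmonic2 n + 1) / 2) * hA -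
        B * (oddHarmonic n - 1 + x) * hx
end
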